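/- (Condition-number form of the perturbed DEIM error bound.) Let W, Ŵ ∈ ℝ^{n×r} have orthonormal columns, let Ŝ ∈ ℝ^{n×s} with s ≥ r, set M̂ = ŜᵀŴ, assume M̂ᵀM̂ is invertible, define D̂ = Ŵ (M̂ᵀM̂)⁻¹ M̂ᵀ Ŝᵀ, and assume D̂ ≠ 0 and D̂ ≠ I. Let sin θ_max := ‖(I − ŴŴᵀ) WWᵀ‖₂. Let f ∈ ℝⁿ satisfy (I − WWᵀ)f ≠ 0. Then ‖f − D̂ f‖₂ ≤ κ · ‖(I − WWᵀ) f‖₂, where κ = (1 + sin θ_max · ‖WWᵀ f‖₂ / ‖(I − WWᵀ) f‖₂) · ‖D̂‖₂. -/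

import Mathlib

open Matrix

/-- Spectral norm (operator norm induced by Euclidean vector norms). -/
noncomputable def spec {m n : ℕ} (M : Matrix (Fin m) (Fin n) ℝ) : ℝ :=
  ‖LinearMap.toContinuousLinearMap (Matrix.toEuclideanLin M)‖

/-- Euclidean norm of a vector. -/
noncomputable def enorm2 {n : ℕ} (v : Fin n → ℝ) : ℝ :=
  Real.sqrt (∑ i, v i ^ 2)

theorem aux_enorm2_eq {n : ℕ} (v : Fin n → ℝ) : enorm2 v = ‖WithLp.toLp 2 v‖ := by
  simp [enorm2, EuclideanSpace.norm_eq]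

theorem aux_mulVec {m n : ℕ} (A : Matrix (Fin m) (Fin n) ℝ) (v : Fin n → ℝ) :
    enorm2 (A.mulVec v) ≤ spec A * enorm2 v := by
  rw [aux_enorm2_eq, aux_enorm2_eq]
  exact (LinearMap.toContinuousLinearMap (Matrix.toEuclideanLin A)).le_opNorm (WithLp.toLp 2 v)

theorem aux_add {n : ℕ} (v w : Fin n → ℝ) : enorm2 (v + w) ≤ enorm2 v + enorm2 w := by
  simp only [aux_enorm2_eq, WithLp.toLp_add]
  exact norm_add_le _ _

open scoped Matrix.Norms.L2Operator in
theorem aux_proj {n : ℕ} (Q : Matrix (Fin n) (Fin n) ℝ) (hs : Qᵀ = Q) (hQ : Q * Q = Q) :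
    spec Q ≤ 1 := by
  have h1 : spec Q = ‖Q‖ := by rw [Matrix.l2_opNorm_def]; rfl
  have h := Matrix.l2_opNorm_conjTranspose_mul_self Q
  rw [Matrix.conjTranspose_eq_transpose_of_trivial, hs, hQ] at h
  rw [h1]
  by_contra hc
  push Not at hc
  nlinarith

theorem aux_idem {E : Type*} [NormedAddCommGroup E] [InnerProductSpace ℝ E]
    (D : E →L[ℝ] E) (hD : ∀ x, D (D x) = D x) (h0 : D ≠ 0) (x : E) :
    ‖x - D x‖ ≤ ‖D‖ * ‖x‖ := by
  by_cases hu : D x = 0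
  · have h1 : 1 ≤ ‖D‖ := by
      obtain ⟨z, hz⟩ : ∃ z, D z ≠ 0 := by
        by_contra! hc
        exact h0 (ContinuousLinearMap.ext hc)
      have := D.le_opNorm (D z)
      rw [hD] at this
      have hp : 0 < ‖D z‖ := norm_pos_iff.mpr hz
      by_contra! hc
      nlinarith
    rw [hu, sub_zero]
    nlinarith [norm_nonneg x]
  by_cases hv : x - D x = 0
  · rw [hv, norm_zero]; positivity
  have hDv : D (x - D x) = 0 := by rw [map_sub, hD, sub_self]
  have hDu := hD x
  obtain ⟨v, hvd⟩ : ∃ v, v = x - D x := ⟨_, rfl⟩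
  obtain ⟨u, hud⟩ : ∃ u, u = D x := ⟨_, rfl⟩
  have hx : x = u + v := by rw [hvd, hud]; abel
  rw [← hvd] at hv hDv ⊢
  rw [← hud] at hu hDu
  have pu : 0 < ‖u‖ := norm_pos_iff.mpr hu
  have pv : 0 < ‖v‖ := norm_pos_iff.mpr hv
  have key := D.le_opNorm ((‖v‖ / ‖u‖) • u + (‖u‖ / ‖v‖) • v)
  have e1 : ‖D ((‖v‖ / ‖u‖) • u + (‖u‖ / ‖v‖) • v)‖ = ‖v‖ := by
    rw [map_add, map_smul, map_smul, hDu, hDv, smul_zero, add_zero, norm_smul, norm_div,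
      norm_norm, norm_norm]
    field_simp
  have e2 : ‖(‖v‖ / ‖u‖) • u + (‖u‖ / ‖v‖) • v‖ = ‖x‖ := by
    rw [← sq_eq_sq₀ (norm_nonneg _) (norm_nonneg _), hx, norm_add_sq_real, norm_add_sq_real,
      norm_smul, norm_smul, norm_div, norm_div, norm_norm, norm_norm,
      real_inner_smul_left, real_inner_smul_right]
    field_simp
    ring
  rwa [e1, e2] at key

theorem aux_idem_mat {n : ℕ} (D : Matrix (Fin n) (Fin n) ℝ) (hD : D * D = D) (h0 : D ≠ 0)
    (x : Fin n → ℝ) : enorm2 (x - D.mulVec x) ≤ spec D * enorm2 x := by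
  have := aux_idem (LinearMap.toContinuousLinearMap (Matrix.toEuclideanLin D)) ?_ ?_
    (WithLp.toLp 2 x)
  · rw [aux_enorm2_eq, aux_enorm2_eq]
    exact this
  · intro y
    simp [Matrix.toLpLin_apply, hD]
  · intro h
    apply h0
    simpa using h

/-- condition-number form of the perturbed DEIM error bound:
    `‖f − D̂ f‖₂ ≤ κ ‖(I − WWᵀ) f‖₂` with
    `κ = (1 + sin θ_max ‖WWᵀ f‖₂ / ‖(I − WWᵀ) f‖₂) ‖D̂‖₂`. -/
theorem perturbed_deim_condition_number_bound {n r s : ℕ} (hrs : r ≤ s)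
    (W What : Matrix (Fin n) (Fin r) ℝ) (Shat : Matrix (Fin n) (Fin s) ℝ)
    (hW : Wᵀ * W = 1) (hWhat : Whatᵀ * What = 1)
    (Mhat : Matrix (Fin s) (Fin r) ℝ) (hMhat : Mhat = Shatᵀ * What)
    (hMinv : IsUnit (Mhatᵀ * Mhat))
    (Dhat : Matrix (Fin n) (Fin n) ℝ)
    (hDhat : Dhat = What * (Mhatᵀ * Mhat)⁻¹ * Mhatᵀ * Shatᵀ)
    (hD0 : Dhat ≠ 0) (hD1 : Dhat ≠ 1)
    (sinθ : ℝ) (hsinθ : sinθ = spec ((1 - What * Whatᵀ) * (W * Wᵀ)))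
    (f : Fin n → ℝ) (hf : (1 - W * Wᵀ).mulVec f ≠ 0)
    (κ : ℝ)
    (hκ : κ = (1 + sinθ * enorm2 ((W * Wᵀ).mulVec f) /
        enorm2 ((1 - W * Wᵀ).mulVec f)) * spec Dhat) :
    enorm2 (f - Dhat.mulVec f) ≤ κ * enorm2 ((1 - W * Wᵀ).mulVec f) := by
  have hdet : IsUnit (Mhatᵀ * Mhat).det := (Matrix.isUnit_iff_isUnit_det _).mp hMinv
  have hDW : Dhat * What = What := by
    rw [hDhat, Matrix.mul_assoc _ Shatᵀ, ← hMhat, Matrix.mul_assoc _ Mhatᵀ, Matrix.mul_assoc,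
      Matrix.nonsing_inv_mul _ hdet, Matrix.mul_one]
  have hDD : Dhat * Dhat = Dhat := by
    conv_lhs => rw [hDhat]
    conv_lhs => rhs; rw [Matrix.mul_assoc, Matrix.mul_assoc]
    rw [← hDhat, ← Matrix.mul_assoc, hDW, hDhat, Matrix.mul_assoc, Matrix.mul_assoc]
  have hPh : (What * Whatᵀ) * (What * Whatᵀ) = What * Whatᵀ := by
    rw [Matrix.mul_assoc, ← Matrix.mul_assoc Whatᵀ, hWhat, Matrix.one_mul]
  have hP : (W * Wᵀ) * (W * Wᵀ) = W * Wᵀ := by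
    rw [Matrix.mul_assoc, ← Matrix.mul_assoc Wᵀ, hW, Matrix.one_mul]
  have hQ1 : spec (1 - What * Whatᵀ) ≤ 1 := by
    apply aux_proj
    · simp
    · rw [Matrix.sub_mul, Matrix.mul_sub (What * Whatᵀ), hPh]; simp
  have hpos : 0 < enorm2 ((1 - W * Wᵀ).mulVec f) := by
    rw [aux_enorm2_eq]
    apply norm_pos_iff.mpr
    simpa using hf
  have hsplit : (1 - What * Whatᵀ).mulVec f =
      ((1 - What * Whatᵀ) * (W * Wᵀ)).mulVec ((W * Wᵀ).mulVec f)
        + (1 - What * Whatᵀ).mulVec ((1 - W * Wᵀ).mulVec f) := by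
    rw [Matrix.mulVec_mulVec, Matrix.mulVec_mulVec, ← Matrix.add_mulVec,
      Matrix.mul_assoc _ (W * Wᵀ), hP, ← Matrix.mul_add]
    simp
  have hb : enorm2 ((1 - What * Whatᵀ).mulVec f) ≤
      sinθ * enorm2 ((W * Wᵀ).mulVec f) + enorm2 ((1 - W * Wᵀ).mulVec f) := by
    rw [hsplit]
    refine (aux_add _ _).trans (add_le_add ?_ ?_)
    · rw [hsinθ]; exact aux_mulVec _ _
    · refine (aux_mulVec _ _).trans ?_
      exact mul_le_of_le_one_left hpos.le hQ1
  have hfac : f - Dhat.mulVec f = (1 - What * Whatᵀ).mulVec f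
      - Dhat.mulVec ((1 - What * Whatᵀ).mulVec f) := by
    rw [Matrix.mulVec_mulVec, Matrix.mul_sub, ← Matrix.mul_assoc, hDW, Matrix.sub_mulVec,
      Matrix.sub_mulVec, Matrix.mul_one, Matrix.one_mulVec]
    abel
  have hs : 0 ≤ spec Dhat := norm_nonneg _
  rw [hfac]
  refine (aux_idem_mat Dhat hDD hD0 _).trans ((mul_le_mul_of_nonneg_left hb hs).trans ?_)
  rw [hκ]
  apply le_of_eq
  field_simp
  ring
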